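/- arXiv:1906.09501 — 9 statements merged into one kernel-verified Lean document; each statement's English description precedes it below -/
import Mathlib

section
/- Let T be a tree with vertex set [n] and let Σ be an n×n real symmetric positive definite matrix belonging to M(T), i.e., (Σ⁻¹)_{ij} = 0 for all i ≠ j with ij not an edge of T. Then for every pair of vertices i, j ∈ [n], the normalized entries satisfy the path-product formula ρ_ij = ∏_{uv ∈ path(i,j)} ρ_uv, where the product runs over the edges of the unique path between i and j in T. -/
open SimpleGraph

/-- The normalized entries of a matrix: `ρ i j = S i j / √(S i i * S j j)`. -/
noncomputable def normEntry {n : ℕ} (S : Matrix (Fin n) (Fin n) ℝ) (i j : Fin n) : ℝ :=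
  S i j / Real.sqrt (S i i * S j j)

/-- If `k` separates `A` from its complement in the sparsity pattern of `S⁻¹`, then
`S i j * S k k = S i k * S k j` for `i ∈ A` and `j ∉ A`. -/
theorem Matrix.PosDef.mul_diag_eq_of_separates {ι : Type*} [Fintype ι] [DecidableEq ι]
    {S : Matrix ι ι ℝ} (hpd : S.PosDef) {A : Set ι} {i j k : ι}
    (hi : i ∈ A) (hj : j ∉ A) (hk : k ∉ A)
    (hsep : ∀ v ∈ A, ∀ u ∉ A, u ≠ k → S⁻¹ v u = 0) :
    S i j * S k k = S i k * S k j := by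
  classical
  let w : ι → ℝ := fun v => S v j * S k k - S v k * S k j
  let x : ι → ℝ := fun v => if v ∈ A then w v else 0
  have hmul : S⁻¹ * S = 1 := Matrix.nonsing_inv_mul S hpd.det_pos.ne'.isUnit
  have hentry (v l : ι) (hv : v ∈ A) (hl : l ∉ A) : ∑ u, S⁻¹ v u * S u l = 0 := by
    rw [← Matrix.mul_apply, hmul, Matrix.one_apply_ne (ne_of_mem_of_not_mem hv hl)]
  have hPw (v : ι) (hv : v ∈ A) : ∑ u, S⁻¹ v u * w u = 0 := by
    have : ∑ u, S⁻¹ v u * w u =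
        (∑ u, S⁻¹ v u * S u j) * S k k - (∑ u, S⁻¹ v u * S u k) * S k j := by
      rw [Finset.sum_mul, Finset.sum_mul, ← Finset.sum_sub_distrib]
      exact Finset.sum_congr rfl fun u _ => by ring
    rw [this, hentry v j hv hj, hentry v k hv hk]
    ring
  have hPx (v : ι) (hv : v ∈ A) : (S⁻¹.mulVec x) v = 0 := by
    rw [← hPw v hv]
    refine Finset.sum_congr rfl fun u _ => ?_
    by_cases hu : u ∈ A
    · simp [x, hu]
    · by_cases huk : u = k
      · subst huk
        simp [x, w, mul_comm]
      · simp [hsep v hv u hu huk]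
  have hx : x = 0 := by
    by_contra hne
    refine (hpd.inv.dotProduct_mulVec_pos hne).ne' (Finset.sum_eq_zero fun v _ => ?_)
    by_cases hv : v ∈ A
    · rw [hPx v hv, mul_zero]
    · simp [x, hv]
  have hwi : w i = 0 := by simpa [x, hi] using congrFun hx i
  exact sub_eq_zero.mp hwi

/-- In an acyclic graph, a vertex `k` on the path from `i` to `j` separates them, so the entries
of a positive definite matrix whose inverse is supported on the graph factor through `k`. -/
theorem SimpleGraph.IsAcyclic.mul_diag_eq_of_mem_support {V : Type*} [Fintype V] [DecidableEq V]
    {T : SimpleGraph V} (hT : T.IsAcyclic) {S : Matrix V V ℝ} (hpd : S.PosDef)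
    (hM : ∀ i j : V, i ≠ j → ¬ T.Adj i j → S⁻¹ i j = 0)
    {i j k : V} {p : T.Walk i j} (hp : p.IsPath) (hk : k ∈ p.support) (hik : i ≠ k) :
    S i j * S k k = S i k * S k j := by
  refine hpd.mul_diag_eq_of_separates (A := {v | ∃ q : T.Walk i v, k ∉ q.support})
    ⟨Walk.nil, by simpa using hik.symm⟩ ?_ ?_ ?_
  · rintro ⟨q, hq⟩
    have hpq : (⟨p, hp⟩ : T.Path i j) = q.toPath := (hT.subsingleton_path i j).elim _ _
    exact hq (q.support_toPath_subset_support (hpq ▸ hk))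
  · rintro ⟨q, hq⟩
    exact hq q.end_mem_support
  · rintro v ⟨q, hq⟩ u hu huk
    refine hM v u (fun h => hu (h ▸ ⟨q, hq⟩)) fun hadj => hu ⟨q.concat hadj, ?_⟩
    simp [Walk.support_concat, hq, huk.symm]

theorem normEntry_self {n : ℕ} {S : Matrix (Fin n) (Fin n) ℝ} {i : Fin n} (hi : 0 < S i i) :
    normEntry S i i = 1 := by
  rw [normEntry, Real.sqrt_mul_self hi.le, div_self hi.ne']

theorem normEntry_eq_mul {n : ℕ} {S : Matrix (Fin n) (Fin n) ℝ} (hdiag : ∀ v, 0 < S v v)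
    {i j k : Fin n} (h : S i j * S k k = S i k * S k j) :
    normEntry S i j = normEntry S i k * normEntry S k j := by
  have hs (v : Fin n) : 0 < √(S v v) := Real.sqrt_pos.mpr (hdiag v)
  have hi := (hs i).ne'
  have hj := (hs j).ne'
  have hk := (hdiag k).ne'
  have hden : √(S i i) * √(S k k) * (√(S k k) * √(S j j)) = √(S i i) * √(S j j) * S k k := by
    linear_combination √(S i i) * √(S j j) * Real.mul_self_sqrt (hdiag k).le
  simp only [normEntry]
  rw [Real.sqrt_mul (hdiag i).le, Real.sqrt_mul (hdiag i).le, Real.sqrt_mul (hdiag k).le,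
    div_mul_div_comm, hden, ← h, mul_div_mul_right _ _ hk]

/-- If `T` is a tree on `[n]` and `S` is a symmetric positive definite
matrix in `M(T)` (i.e. `(S⁻¹) i j = 0` whenever `i ≠ j` and `ij` is not an edge of `T`),
then the normalized entries satisfy the path-product formula along the (unique) path
between any two vertices. -/
theorem tree_model_path_product {n : ℕ} (T : SimpleGraph (Fin n)) (hT : T.IsTree)
    (S : Matrix (Fin n) (Fin n) ℝ) (hpd : S.PosDef) (hsymm : S.IsSymm)
    (hM : ∀ i j : Fin n, i ≠ j → ¬ T.Adj i j → S⁻¹ i j = 0) :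
    ∀ (i j : Fin n) (p : T.Path i j),
      normEntry S i j =
        ((p : T.Walk i j).darts.map (fun d => normEntry S d.toProd.1 d.toProd.2)).prod := by
  rintro i j ⟨p, hp⟩
  have hdiag (v : Fin n) : 0 < S v v := hpd.diag_pos
  induction p with
  | nil => simpa using normEntry_self (hdiag _)
  | cons h p ih =>
    rw [Walk.darts_cons, List.map_cons, List.prod_cons, ← ih hp.of_cons]
    exact normEntry_eq_mul hdiag
      (hT.isAcyclic.mul_diag_eq_of_mem_support hpd hM hp (by simp) h.ne)
end

section
/- Let T be a tree with vertex set [n] and let Σ be an n×n real symmetric positive definite matrix whose normalized entries ρ_ij = σ_ij/√(σ_ii σ_jj) satisfy the path-product formula ρ_ij = ∏_{uv ∈ path(i,j)} ρ_uv for all i, j ∈ [n]. Then Σ ∈ M(T), i.e., (Σ⁻¹)_{ij} = 0 for every pair i ≠ j such that ij is not an edge of T. -/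
open SimpleGraph

/-- The `2 × 2` principal minors of a positive definite matrix are positive. -/
lemma Matrix.PosDef.sq_lt_mul_diag {ι : Type*} [Fintype ι] [DecidableEq ι] {S : Matrix ι ι ℝ}
    (hS : S.PosDef) {i j : ι} (hij : i ≠ j) : S i j ^ 2 < S i i * S j j := by
  have hinj : Function.Injective ![i, j] := by
    intro a b
    fin_cases a <;> fin_cases b <;> simp [hij, hij.symm]
  have hdet := (hS.submatrix hinj).det_pos
  have hsymm : S j i = S i j := by simpa using hS.isHermitian.apply i j
  simp only [Matrix.det_fin_two, Matrix.submatrix_apply, Matrix.cons_val_zero,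
    Matrix.cons_val_one, hsymm] at hdet
  nlinarith

/-- Clearing denominators in a factorization of a normalized entry. -/
lemma mul_diag_eq_of_normEntry_eq_mul {n : ℕ} {S : Matrix (Fin n) (Fin n) ℝ}
    (hdiag : ∀ i, 0 < S i i) {i j k : Fin n}
    (h : normEntry S i k = normEntry S i j * normEntry S j k) :
    S i k * S j j = S i j * S j k := by
  unfold normEntry at h
  have hi := Real.sqrt_pos.2 (hdiag i)
  have hj := Real.sqrt_pos.2 (hdiag j)
  have hk := Real.sqrt_pos.2 (hdiag k)
  rw [Real.sqrt_mul (hdiag i).le, Real.sqrt_mul (hdiag i).le, Real.sqrt_mul (hdiag j).le] at h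
  field_simp at h
  rwa [Real.sq_sqrt (hdiag j).le] at h

/-- In an acyclic graph, the only neighbor of `u` on a path starting at `u` is its
second vertex. -/
lemma SimpleGraph.IsAcyclic.eq_of_adj_of_mem_support {V : Type*} {G : SimpleGraph V}
    (hG : G.IsAcyclic) {u v w k : V} {h : G.Adj u v} {p : G.Walk v w}
    (hp : (Walk.cons h p).IsPath) (huk : G.Adj u k) (hk : k ∈ p.support) : k = v := by
  classical
  rw [Walk.cons_isPath_iff] at hp
  have hq : (Walk.cons h (p.takeUntil k hk)).IsPath :=
    (Walk.cons_isPath_iff _ _).2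
      ⟨hp.1.takeUntil hk, fun hu => hp.2 (p.support_takeUntil_subset_support hk hu)⟩
  have heq := (hG.subsingleton_path u k).elim ⟨_, hq⟩ (Path.singleton huk)
  have hlen := congrArg (fun q : G.Path u k => (q : G.Walk u k).length) heq
  simp only [Path.singleton, Walk.length_cons, Walk.length_nil] at hlen
  exact (Walk.eq_of_length_eq_zero (p := p.takeUntil k hk) (by omega)).symm

/-- If row `i` of a positive definite matrix satisfies the Markov-type factorizations through
`m` and through `j`, then it annihilates the candidate `j`-th column of the inverse
supported on `j` and the set `N`. -/
lemma Matrix.PosDef.candidate_column_eq_zero {ι : Type*} [Fintype ι] [DecidableEq ι]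
    {S : Matrix ι ι ℝ} (hS : S.PosDef) {N : Finset ι} {i j m : ι} (hm : m ∈ N) (hjm : j ≠ m)
    (h₁ : S j i * S m m = S j m * S m i)
    (h₂ : ∀ k ∈ N, k ≠ m → S k i * S j j = S k j * S j i) :
    S i j * ((1 + ∑ k ∈ N, S j k / (S j j * S k k - S j k ^ 2) * S j k) / S j j)
      - ∑ k ∈ N, S i k * (S j k / (S j j * S k k - S j k ^ 2)) = 0 := by
  have hsymm : ∀ a b, S a b = S b a := fun a b => by simpa using hS.isHermitian.apply b a
  have hj : S j j ≠ 0 := hS.diag_pos.ne'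
  have hd : S j j * S m m - S j m ^ 2 ≠ 0 := (sub_pos.2 (hS.sq_lt_mul_diag hjm)).ne'
  have hsum : ∑ k ∈ N, S j k / (S j j * S k k - S j k ^ 2) * (S i j * S j k / S j j - S i k)
      = - (S i j / S j j) := by
    rw [Finset.sum_eq_single_of_mem m hm]
    · rw [hsymm j i, hsymm m i] at h₁
      field_simp
      linear_combination (S j j) * h₁
    · intro k hk hkm
      have h := h₂ k hk hkm
      rw [hsymm k i, hsymm k j, hsymm j i] at h
      rw [show S i j * S j k / S j j - S i k = 0 by field_simp; linarith, mul_zero]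
  have hsplit : S i j * ((1 + ∑ k ∈ N, S j k / (S j j * S k k - S j k ^ 2) * S j k) / S j j)
      - ∑ k ∈ N, S i k * (S j k / (S j j * S k k - S j k ^ 2))
      = S i j / S j j + ∑ k ∈ N, S j k / (S j j * S k k - S j k ^ 2) *
        (S i j * S j k / S j j - S i k) := by
    rw [mul_div_assoc', mul_add, add_div, mul_one, Finset.mul_sum, Finset.sum_div, add_sub_assoc,
      ← Finset.sum_sub_distrib]
    congr 1
    exact Finset.sum_congr rfl fun k _ => by ring
  rw [hsplit, hsum, add_neg_cancel]

/-- If `T` is a tree on `[n]` and `S` is a symmetric positive definite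
matrix whose normalized entries satisfy the path-product formula over `T`, then
`S ∈ M(T)`, i.e. `(S⁻¹) i j = 0` for every pair `i ≠ j` with `ij` not an edge of `T`. -/
theorem path_product_tree_model {n : ℕ} (T : SimpleGraph (Fin n)) (hT : T.IsTree)
    (S : Matrix (Fin n) (Fin n) ℝ) (hpd : S.PosDef) (hsymm : S.IsSymm)
    (hprod : ∀ (i j : Fin n) (p : T.Path i j),
      normEntry S i j =
        ((p : T.Walk i j).darts.map (fun d => normEntry S d.toProd.1 d.toProd.2)).prod) :
    ∀ i j : Fin n, i ≠ j → ¬ T.Adj i j → S⁻¹ i j = 0 := by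
  classical
  have hdiag : ∀ i, 0 < S i i := fun _ => hpd.diag_pos
  have hcons : ∀ {i j k : Fin n} (h : T.Adj i j) (p : T.Walk j k), (Walk.cons h p).IsPath →
      S i k * S j j = S i j * S j k := fun {i j k} h p hp => by
    apply mul_diag_eq_of_normEntry_eq_mul hdiag
    rw [hprod i k ⟨_, hp⟩, hprod j k ⟨p, hp.of_cons⟩]
    simp
  intro i j hij hadj
  set c : Fin n → ℝ := fun k => S j k / (S j j * S k k - S j k ^ 2)
  set N : Finset (Fin n) := T.neighborFinset j with hN
  set w : Fin n → ℝ := Pi.single j ((1 + ∑ k ∈ N, c k * S j k) / S j j)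
    - fun k => if k ∈ N then c k else 0 with hw
  have hmul : ∀ a, (S.mulVec w) a
      = S a j * ((1 + ∑ k ∈ N, c k * S j k) / S j j) - ∑ k ∈ N, S a k * c k := fun a => by
    rw [hw, Matrix.mulVec_sub, Pi.sub_apply, Matrix.mulVec_single]
    simp [Matrix.mulVec, dotProduct, div_eq_mul_inv]
  have hSw : S.mulVec w = Pi.single j 1 := by
    funext a
    rw [hmul]
    obtain rfl | ha := eq_or_ne a j
    · have := (hdiag a).ne'
      rw [Pi.single_eq_same, mul_div_cancel₀ _ this, add_sub_assoc, ← Finset.sum_sub_distrib,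
        Finset.sum_eq_zero fun k _ => by ring, add_zero]
    · rw [Pi.single_eq_of_ne ha]
      obtain ⟨p, hp⟩ := hT.connected.exists_isPath j a
      cases p with
      | nil => exact absurd rfl ha
      | @cons _ m _ h q =>
        refine hpd.candidate_column_eq_zero (m := m) (by simpa [hN] using h) h.ne
          (hcons h q hp) fun k hk hkm => ?_
        have hjk : T.Adj j k := by simpa [hN] using hk
        refine hcons hjk.symm _ ((Walk.cons_isPath_iff _ _).2 ⟨hp, fun hmem => ?_⟩)
        rw [Walk.support_cons, List.mem_cons] at hmem
        exact hmem.elim hjk.ne' fun hkq =>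
          hkm (hT.isAcyclic.eq_of_adj_of_mem_support hp hjk hkq)
  have hinv : S⁻¹.mulVec (Pi.single j 1) = w := by
    rw [← hSw, Matrix.mulVec_mulVec,
      Matrix.nonsing_inv_mul _ (Matrix.isUnit_iff_isUnit_det _ |>.1 hpd.isUnit), Matrix.one_mulVec]
  have hcol := congrFun hinv i
  rw [Matrix.mulVec_single_one] at hcol
  have hiN : i ∉ N := by simpa [hN, T.adj_comm j i] using hadj
  simpa [hw, hiN, Pi.single_eq_of_ne hij] using hcol
end

section
/- Let G be a connected graph on vertex set [n] and let Σ ∈ M(G) be generic. Then for all subsets A, B, C ⊆ [n], rank(Σ_{A∪C, B∪C}) = rank(Σ_{A,B}) if and only if C is a subset of some minimal separator of A and B in G. -/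
open SimpleGraph

/-- `S` separates `A` and `B` in `G`: every walk from a vertex of `A` to a vertex of `B`
passes through a vertex of `S`. -/
def Separates {n : ℕ} (G : SimpleGraph (Fin n)) (A B S : Finset (Fin n)) : Prop :=
  ∀ a ∈ A, ∀ b ∈ B, ∀ p : G.Walk a b, ∃ s ∈ p.support, s ∈ S

/-- A minimal separator of `A` and `B`: a separator of minimum cardinality. -/
def IsMinimalSeparator {n : ℕ} (G : SimpleGraph (Fin n)) (A B S : Finset (Fin n)) : Prop :=
  Separates G A B S ∧ ∀ S' : Finset (Fin n), Separates G A B S' → S.card ≤ S'.card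

/-- The submatrix of `S` with rows indexed by `A` and columns indexed by `B`. -/
def subm {n : ℕ} (S : Matrix (Fin n) (Fin n) ℝ) (A B : Finset (Fin n)) :
    Matrix A B ℝ :=
  S.submatrix (fun a : A => (a : Fin n)) (fun b : B => (b : Fin n))

/-- `S` is generic for `G`: the rank of every submatrix `S_{A,B}` equals the minimum
size of a separator of `A` and `B` in `G`. -/
def IsGeneric {n : ℕ} (G : SimpleGraph (Fin n)) (S : Matrix (Fin n) (Fin n) ℝ) : Prop :=
  ∀ A B : Finset (Fin n),
    (subm S A B).rank = sInf {k : ℕ | ∃ S' : Finset (Fin n), Separates G A B S' ∧ S'.card = k}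

/-- A separator of the larger sets separates the smaller ones. -/
theorem Separates.mono {n : ℕ} {G : SimpleGraph (Fin n)} {A A' B B' S : Finset (Fin n)}
    (h : Separates G A' B' S) (hA : A ⊆ A') (hB : B ⊆ B') : Separates G A B S :=
  fun a ha b hb p => h a (hA ha) b (hB hb) p

theorem Separates.inter_subset {n : ℕ} {G : SimpleGraph (Fin n)} {A B S : Finset (Fin n)}
    (h : Separates G A B S) : A ∩ B ⊆ S := by
  intro c hc
  obtain ⟨hA, hB⟩ := Finset.mem_inter.mp hc
  obtain ⟨s, hs, hsS⟩ := h c hA c hB Walk.nil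
  rw [Walk.support_nil, List.mem_singleton] at hs
  exact hs ▸ hsS

/-- Enlarging both sets by part of a separator keeps it a separator. -/
theorem Separates.union {n : ℕ} {G : SimpleGraph (Fin n)} {A B C S : Finset (Fin n)}
    (h : Separates G A B S) (hC : C ⊆ S) : Separates G (A ∪ C) (B ∪ C) S := by
  intro a ha b hb p
  rcases Finset.mem_union.mp ha with ha | ha
  · rcases Finset.mem_union.mp hb with hb | hb
    · exact h a ha b hb p
    · exact ⟨b, p.end_mem_support, hC hb⟩
  · exact ⟨a, p.start_mem_support, hC ha⟩

theorem exists_isMinimalSeparator {n : ℕ} (G : SimpleGraph (Fin n)) (A B : Finset (Fin n)) :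
    ∃ S, IsMinimalSeparator G A B S := by
  have huniv : Separates G A B Finset.univ :=
    fun a _ _ _ p => ⟨a, p.start_mem_support, Finset.mem_univ a⟩
  obtain ⟨S, hS, hmin⟩ :=
    Set.exists_min_image {S | Separates G A B S} Finset.card (Set.toFinite _) ⟨_, huniv⟩
  exact ⟨S, hS, hmin⟩

theorem IsMinimalSeparator.rank_subm_eq {n : ℕ} {G : SimpleGraph (Fin n)}
    {M : Matrix (Fin n) (Fin n) ℝ} {A B S : Finset (Fin n)} (hS : IsMinimalSeparator G A B S)
    (hM : IsGeneric G M) : (subm M A B).rank = S.card := by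
  rw [hM A B]
  apply le_antisymm
  · exact Nat.sInf_le ⟨S, hS.1, rfl⟩
  · refine le_csInf ⟨_, S, hS.1, rfl⟩ ?_
    rintro _ ⟨S', hS', rfl⟩
    exact hS.2 S' hS'

/-- For a connected graph `G` on `[n]` and a generic `S ∈ M(G)`:
for all subsets `A`, `B`, `C`, `rank S_{A∪C,B∪C} = rank S_{A,B}` iff `C` is contained in
some minimal separator of `A` and `B` in `G`. -/
theorem rank_eq_iff_subset_minimal_separator {n : ℕ} (G : SimpleGraph (Fin n))
    (hG : G.Connected) (S : Matrix (Fin n) (Fin n) ℝ) (hpd : S.PosDef) (hsymm : S.IsSymm)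
    (hM : ∀ i j : Fin n, i ≠ j → ¬ G.Adj i j → S⁻¹ i j = 0)
    (hgen : IsGeneric G S) :
    ∀ A B C : Finset (Fin n),
      ((subm S (A ∪ C) (B ∪ C)).rank = (subm S A B).rank ↔
        ∃ S' : Finset (Fin n), IsMinimalSeparator G A B S' ∧ C ⊆ S') := by
  intro A B C
  constructor
  · intro hrank
    obtain ⟨T, hT⟩ := exists_isMinimalSeparator G (A ∪ C) (B ∪ C)
    obtain ⟨T₀, hT₀⟩ := exists_isMinimalSeparator G A B
    rw [hT.rank_subm_eq hgen, hT₀.rank_subm_eq hgen] at hrank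
    refine ⟨T, ⟨hT.1.mono Finset.subset_union_left Finset.subset_union_left,
      fun S' hS' => hrank ▸ hT₀.2 S' hS'⟩, fun c hc => hT.1.inter_subset ?_⟩
    simp [hc]
  · rintro ⟨T, hT, hCT⟩
    have hT' : IsMinimalSeparator G (A ∪ C) (B ∪ C) T :=
      ⟨hT.1.union hCT, fun S' hS' =>
        hT.2 S' (hS'.mono Finset.subset_union_left Finset.subset_union_left)⟩
    rw [hT'.rank_subm_eq hgen, hT.rank_subm_eq hgen]
end

section
/- Let G = (V, E) be a graph with |V| ≥ 2 and let δ > 0. If a vertex v satisfies s(v) < s(v°) + 2δ, where v° minimizes s, then c(v) < √(s(v°) + 2δ) ≤ √(c(v*) + 2δ), where v* minimizes c. In particular, if G is a tree with |V| ≥ 4 and δ < 1/6, then c(v) < 1. -/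
open SimpleGraph

variable {V : Type*}

/-- `u` and `w` are connected by a walk in `G` avoiding the set `S`
(i.e. they lie in the same connected component of `G ∖ S`). -/
def ReachAvoid (G : SimpleGraph V) (S : Set V) (u w : V) : Prop :=
  ∃ p : G.Walk u w, ∀ x ∈ p.support, x ∉ S

/-- The connected component of `v` in `G ∖ S` (as a set of vertices). -/
def compAvoid (G : SimpleGraph V) (S : Set V) (v : V) : Set V :=
  {w | ReachAvoid G S v w}

/-- The set `𝒞^S` of connected components of `G ∖ S`. -/
def comps (G : SimpleGraph V) (S : Set V) : Set (Set V) :=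
  {C | ∃ v, v ∉ S ∧ C = compAvoid G S v}

/-- The size of the largest connected component of `G ∖ S`. -/
noncomputable def maxComp [Fintype V] (G : SimpleGraph V) (S : Set V) : ℕ :=
  sSup {k : ℕ | ∃ C ∈ comps G S, k = C.ncard}

/-- The centrality `c(S) = (1/|V ∖ S|) · max_{C ∈ 𝒞^S} |C|`. -/
noncomputable def cent [Fintype V] (G : SimpleGraph V) (S : Set V) : ℝ :=
  (maxComp G S : ℝ) / ((Sᶜ : Set V).ncard : ℝ)

/-- The s-centrality `s(v) = (1/(|V|−1)²) · Σ_{C ∈ 𝒞^v} |C|²`. -/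
noncomputable def scent [Fintype V] (G : SimpleGraph V) (v : V) : ℝ :=
  (∑ᶠ C ∈ comps G {v}, ((C.ncard : ℝ)) ^ 2) / ((Fintype.card V - 1 : ℝ)) ^ 2

namespace ReachAvoid

variable {G : SimpleGraph V} {S : Set V} {u w x : V}

theorem refl (hu : u ∉ S) : ReachAvoid G S u u :=
  ⟨Walk.nil, by simpa using hu⟩

theorem symm (h : ReachAvoid G S u w) : ReachAvoid G S w u := by
  obtain ⟨p, hp⟩ := h
  exact ⟨p.reverse, by simpa using hp⟩

theorem trans (h₁ : ReachAvoid G S u w) (h₂ : ReachAvoid G S w x) : ReachAvoid G S u x := by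
  obtain ⟨p, hp⟩ := h₁
  obtain ⟨q, hq⟩ := h₂
  refine ⟨p.append q, fun y hy => ?_⟩
  rcases (Walk.mem_support_append_iff _ _).1 hy with h | h
  exacts [hp y h, hq y h]

theorem of_adj (h : G.Adj u w) (hu : u ∉ S) (hw : w ∉ S) : ReachAvoid G S u w := by
  refine ⟨h.toWalk, fun y hy => ?_⟩
  have hy' : y = u ∨ y = w := by simpa using hy
  rcases hy' with rfl | rfl <;> assumption

theorem right_notMem (h : ReachAvoid G S u w) : w ∉ S := by
  obtain ⟨p, hp⟩ := h
  exact hp w p.end_mem_support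

end ReachAvoid

theorem compAvoid_eq_of_reachAvoid {G : SimpleGraph V} {S : Set V} {u w : V}
    (h : ReachAvoid G S u w) : compAvoid G S u = compAvoid G S w :=
  Set.ext fun _ => ⟨fun hx => h.symm.trans hx, fun hx => h.trans hx⟩

theorem pairwiseDisjoint_comps (G : SimpleGraph V) (S : Set V) :
    (comps G S).PairwiseDisjoint id := by
  rintro _ ⟨a, -, rfl⟩ _ ⟨b, -, rfl⟩ hne
  refine Set.disjoint_left.2 fun x hxa hxb => hne ?_
  exact (compAvoid_eq_of_reachAvoid hxa).trans (compAvoid_eq_of_reachAvoid hxb).symm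

theorem ncard_le_maxComp [Fintype V] {G : SimpleGraph V} {S C : Set V} (hC : C ∈ comps G S) :
    C.ncard ≤ maxComp G S := by
  refine le_csSup ⟨Fintype.card V, ?_⟩ ⟨C, hC, rfl⟩
  rintro k ⟨D, -, rfl⟩
  rw [← Nat.card_eq_fintype_card]
  exact Set.ncard_le_card D

theorem exists_ncard_eq_maxComp [Fintype V] {G : SimpleGraph V} {S : Set V}
    (h : (comps G S).Nonempty) : ∃ C ∈ comps G S, C.ncard = maxComp G S := by
  have hne : {k : ℕ | ∃ C ∈ comps G S, k = C.ncard}.Nonempty :=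
    h.imp' Set.ncard fun C hC => ⟨C, hC, rfl⟩
  obtain ⟨C, hC, h⟩ := Nat.sSup_mem hne ⟨Fintype.card V, by
    rintro k ⟨D, -, rfl⟩
    rw [← Nat.card_eq_fintype_card]
    exact Set.ncard_le_card D⟩
  exact ⟨C, hC, h.symm⟩

theorem comps_singleton_nonempty [Fintype V] (G : SimpleGraph V) (hV : 2 ≤ Fintype.card V)
    (v : V) : (comps G {v}).Nonempty := by
  have : Nontrivial V := Fintype.one_lt_card_iff_nontrivial.1 hV
  obtain ⟨u, hu⟩ := exists_ne v
  exact ⟨_, u, hu, rfl⟩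

theorem ncard_compl_singleton_cast [Fintype V] (v : V) :
    ((({v} : Set V)ᶜ).ncard : ℝ) = Fintype.card V - 1 := by
  have h := Set.ncard_add_ncard_compl ({v} : Set V)
  rw [Set.ncard_singleton, Nat.card_eq_fintype_card] at h
  rw [← h]
  push_cast
  ring

theorem sum_ncard_comps_le [Fintype V] (G : SimpleGraph V) (S : Set V) :
    ∑ C ∈ (comps G S).toFinite.toFinset, C.ncard ≤ (Sᶜ : Set V).ncard := by
  have hU : (⋃ C ∈ comps G S, C).ncard = ∑ C ∈ (comps G S).toFinite.toFinset, C.ncard := by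
    rw [← finsum_mem_eq_finite_toFinset_sum]
    exact Set.Finite.ncard_biUnion (comps G S).toFinite (fun C _ => C.toFinite)
      (pairwiseDisjoint_comps G S)
  rw [← hU]
  refine Set.ncard_le_ncard (Set.iUnion₂_subset ?_) (Set.toFinite _)
  rintro _ ⟨a, -, rfl⟩ x hx
  exact ReachAvoid.right_notMem hx

theorem scent_eq_sum [Fintype V] (G : SimpleGraph V) (v : V) :
    scent G v = (∑ C ∈ (comps G {v}).toFinite.toFinset, (C.ncard : ℝ) ^ 2) /
      (Fintype.card V - 1 : ℝ) ^ 2 := by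
  rw [scent, finsum_mem_eq_finite_toFinset_sum]

theorem cent_singleton [Fintype V] (G : SimpleGraph V) (v : V) :
    cent G {v} = maxComp G {v} / (Fintype.card V - 1 : ℝ) := by
  rw [cent, ncard_compl_singleton_cast]

theorem cent_sq_le_scent [Fintype V] (G : SimpleGraph V) (hV : 2 ≤ Fintype.card V) (v : V) :
    cent G {v} ^ 2 ≤ scent G v := by
  obtain ⟨C, hC, h⟩ := exists_ncard_eq_maxComp (comps_singleton_nonempty G hV v)
  rw [cent_singleton, scent_eq_sum, div_pow, ← h]
  gcongr
  exact Finset.single_le_sum (f := fun C : Set V => (C.ncard : ℝ) ^ 2)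
    (fun _ _ => sq_nonneg _) ((Set.Finite.mem_toFinset _).2 hC)

theorem scent_le_cent [Fintype V] (G : SimpleGraph V) (hV : 2 ≤ Fintype.card V) (v : V) :
    scent G v ≤ cent G {v} := by
  have hn : (0 : ℝ) < Fintype.card V - 1 := by
    have : (2 : ℝ) ≤ Fintype.card V := by exact_mod_cast hV
    linarith
  have hsum : (∑ C ∈ (comps G {v}).toFinite.toFinset, (C.ncard : ℝ)) ≤ Fintype.card V - 1 := by
    rw [← ncard_compl_singleton_cast v]
    exact_mod_cast sum_ncard_comps_le G {v}
  rw [cent_singleton, scent_eq_sum, div_le_div_iff₀ (by positivity) hn]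
  have hsq : (∑ C ∈ (comps G {v}).toFinite.toFinset, (C.ncard : ℝ) ^ 2) ≤
      maxComp G {v} * (Fintype.card V - 1 : ℝ) := calc
    _ ≤ ∑ C ∈ (comps G {v}).toFinite.toFinset, (maxComp G {v} : ℝ) * C.ncard := by
      refine Finset.sum_le_sum fun C hC => ?_
      rw [sq]
      gcongr
      exact ncard_le_maxComp ((Set.Finite.mem_toFinset _).1 hC)
    _ ≤ _ := by
      rw [← Finset.mul_sum]
      gcongr
  nlinarith

/-- In an acyclic graph, a component of `G ∖ v` contains at most one neighbour of `v`. -/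
theorem SimpleGraph.IsAcyclic.eq_of_adj_of_reachAvoid {G : SimpleGraph V} (hG : G.IsAcyclic)
    {v w x : V} (hw : G.Adj v w) (hx : G.Adj v x) (h : ReachAvoid G {v} w x) : w = x := by
  classical
  obtain ⟨p, hp⟩ := h
  have hv : v ∉ p.bypass.support := fun hmem => hp v (p.support_bypass_subset_support hmem) rfl
  have hpath : (Walk.cons hw p.bypass).IsPath :=
    (Walk.cons_isPath_iff _ _).2 ⟨p.bypass_isPath, hv⟩
  have hpath' : hx.toWalk.IsPath := by simpa [Walk.cons_isPath_iff] using hx.ne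
  have heq : Walk.cons hw p.bypass = hx.toWalk :=
    congrArg Subtype.val ((hG.subsingleton_path v x).elim ⟨_, hpath⟩ ⟨_, hpath'⟩)
  have hmem : w ∈ hx.toWalk.support := by
    rw [← heq]
    simp
  have hmem' : w = v ∨ w = x := by simpa using hmem
  exact hmem'.resolve_left hw.ne'

/-- Moving from `v` to its neighbour `w` in a component `C` of `G ∖ v`, every component of
`G ∖ w` lies inside `C ∖ {w}` or outside `C`. -/
theorem SimpleGraph.IsAcyclic.comps_subset_or_subset {G : SimpleGraph V} (hG : G.IsAcyclic)
    {v w : V} (hw : G.Adj v w) {D : Set V} (hD : D ∈ comps G {w}) :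
    D ⊆ compAvoid G {v} w \ {w} ∨ D ⊆ (compAvoid G {v} w)ᶜ := by
  obtain ⟨d, -, rfl⟩ := hD
  by_contra! h
  obtain ⟨h₁, h₂⟩ := h
  obtain ⟨y, hy, hyC⟩ := Set.not_subset.1 h₁
  obtain ⟨x, hx, hxC⟩ := Set.not_subset.1 h₂
  replace hxC : x ∈ compAvoid G {v} w := not_not.1 hxC
  replace hyC : y ∉ compAvoid G {v} w := fun h => hyC ⟨h, ReachAvoid.right_notMem hy⟩
  obtain ⟨p, hp⟩ := (ReachAvoid.symm hx).trans hy
  obtain ⟨e, he, hfst, hsnd⟩ := p.exists_boundary_dart _ hxC hyC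
  have hev : e.snd = v := by
    by_contra hne
    exact hsnd (ReachAvoid.trans hfst
      (ReachAvoid.of_adj e.adj (ReachAvoid.right_notMem hfst) hne))
  have hadj : G.Adj v e.fst := hev ▸ e.adj.symm
  exact hp e.fst (p.dart_fst_mem_support_of_mem_darts he)
    (hG.eq_of_adj_of_reachAvoid hw hadj hfst).symm

theorem SimpleGraph.Preconnected.exists_adj_reachAvoid {G : SimpleGraph V}
    (hG : G.Preconnected) {v a : V} (ha : a ≠ v) : ∃ w, G.Adj v w ∧ ReachAvoid G {v} w a := by
  obtain ⟨p, hp⟩ := (hG v a).exists_isPath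
  cases p with
  | nil => exact absurd rfl ha
  | cons h q =>
    refine ⟨_, h, q, ?_⟩
    rintro x hx rfl
    exact ((Walk.cons_isPath_iff _ _).1 hp).2 hx

/-- A vertex of a tree minimizing the largest component is a centroid. -/
theorem SimpleGraph.IsTree.two_mul_maxComp_le [Fintype V] {G : SimpleGraph V} (hG : G.IsTree)
    (hV : 2 ≤ Fintype.card V) {v : V} (hv : ∀ u, maxComp G {v} ≤ maxComp G {u}) :
    2 * maxComp G {v} ≤ Fintype.card V := by
  by_contra! hlt
  obtain ⟨_, ⟨a, ha, rfl⟩, hM⟩ := exists_ncard_eq_maxComp (comps_singleton_nonempty G hV v)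
  obtain ⟨w, hw, hwa⟩ := hG.connected.preconnected.exists_adj_reachAvoid ha
  rw [← compAvoid_eq_of_reachAvoid hwa] at hM
  obtain ⟨D, hD, hDM⟩ := exists_ncard_eq_maxComp (comps_singleton_nonempty G hV w)
  have hle := hv w
  rw [← hDM] at hle
  rcases hG.isAcyclic.comps_subset_or_subset hw hD with h | h
  · have hwC : w ∈ compAvoid G {v} w := ReachAvoid.refl hw.ne'
    have h₁ := Set.ncard_le_ncard h (Set.toFinite _)
    have h₂ := Set.ncard_sdiff_singleton_lt_of_mem hwC (Set.toFinite _)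
    omega
  · have h₁ := Set.ncard_le_ncard h (Set.toFinite _)
    have h₂ := Set.ncard_add_ncard_compl (compAvoid G {v} w)
    rw [Nat.card_eq_fintype_card] at h₂
    omega

/-- If `s(v) < s(v°) + 2δ` where `v°` minimizes `s`, then
`c(v) < √(s(v°)+2δ) ≤ √(c(v*)+2δ)` where `v*` minimizes `c`; in particular, if `G` is a
tree with at least 4 vertices and `δ < 1/6`, then `c(v) < 1`. -/
theorem cent_lt_sqrt_of_scent_lt [Fintype V] (G : SimpleGraph V)
    (hV : 2 ≤ Fintype.card V) (δ : ℝ) (hδ : 0 < δ) (v vs vc : V)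
    (hvs : ∀ u : V, scent G vs ≤ scent G u) (hvc : ∀ u : V, cent G {vc} ≤ cent G {u})
    (hv : scent G v < scent G vs + 2 * δ) :
    (cent G {v} < Real.sqrt (scent G vs + 2 * δ) ∧
      Real.sqrt (scent G vs + 2 * δ) ≤ Real.sqrt (cent G {vc} + 2 * δ)) ∧
    ((G.IsTree ∧ 4 ≤ Fintype.card V ∧ δ < 1 / 6) → cent G {v} < 1) := by
  have hn : (0 : ℝ) < Fintype.card V - 1 := by
    have : (2 : ℝ) ≤ Fintype.card V := by exact_mod_cast hV
    linarith
  have hlt : cent G {v} < Real.sqrt (scent G vs + 2 * δ) :=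
    Real.lt_sqrt_of_sq_lt ((cent_sq_le_scent G hV v).trans_lt hv)
  have hle : Real.sqrt (scent G vs + 2 * δ) ≤ Real.sqrt (cent G {vc} + 2 * δ) := by
    have := (hvs vc).trans (scent_le_cent G hV vc)
    gcongr
  refine ⟨⟨hlt, hle⟩, fun ⟨hG, hV', hδ'⟩ => (hlt.trans_le hle).trans_le ?_⟩
  have hmin : ∀ u, maxComp G {vc} ≤ maxComp G {u} := fun u => by
    have h := hvc u
    rw [cent_singleton, cent_singleton, div_le_div_iff_of_pos_right hn] at h
    exact_mod_cast h
  have hM : (2 : ℝ) * maxComp G {vc} ≤ Fintype.card V := by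
    exact_mod_cast hG.two_mul_maxComp_le hV hmin
  have hV4 : (4 : ℝ) ≤ Fintype.card V := by exact_mod_cast hV'
  have hc : cent G {vc} ≤ 2 / 3 := by
    rw [cent_singleton, div_le_iff₀ hn]
    linarith
  rw [Real.sqrt_le_one]
  linarith
end

section
/- Let U be a finite set partitioned into pairwise disjoint sets C_1, …, C_d with |C_1| ≥ |C_2| ≥ … ≥ |C_d| ≥ 0, and let α ≥ 2/3. If |C_1| ≤ α|U|, then there exists an index t ∈ {1, …, d} such that (1−α)|U| ≤ Σ_{i=1}^{t} |C_i| ≤ α|U|. -/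
/-- Let `U` be a finite set partitioned into pairwise disjoint sets
`C 0, …, C (d-1)` listed in weakly decreasing order of size, and let `α ≥ 2/3`.
If `|C 0| ≤ α|U|` then there is an index `t` with
`(1−α)|U| ≤ Σ_{i ≤ t} |C i| ≤ α|U|`. -/
theorem partition_grouping {β : Type*} [DecidableEq β] (U : Finset β) (d : ℕ) (hd : 0 < d)
    (C : Fin d → Finset β)
    (hdisj : ∀ i j : Fin d, i ≠ j → Disjoint (C i) (C j))
    (hcover : Finset.univ.biUnion C = U)
    (hmono : ∀ i j : Fin d, i ≤ j → (C j).card ≤ (C i).card)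
    (α : ℝ) (hα : 2 / 3 ≤ α)
    (hC1 : ((C ⟨0, hd⟩).card : ℝ) ≤ α * U.card) :
    ∃ t : Fin d,
      (1 - α) * U.card ≤ (∑ i ∈ Finset.Iic t, ((C i).card : ℝ)) ∧
        (∑ i ∈ Finset.Iic t, ((C i).card : ℝ)) ≤ α * U.card := by
  have hsum : (∑ i, ((C i).card : ℝ)) = U.card := by
    rw [← hcover, Finset.card_biUnion fun i _ j _ hij => hdisj i j hij]
    push_cast
    rfl
  have hn : (0 : ℝ) ≤ U.card := Nat.cast_nonneg _
  by_contra! hno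
  have hsmall : ∀ k (hk : k < d),
      (∑ i ∈ Finset.Iic (⟨k, hk⟩ : Fin d), ((C i).card : ℝ)) < (1 - α) * U.card := by
    intro k
    induction k with
    | zero =>
      intro hk
      have hIic : Finset.Iic (⟨0, hk⟩ : Fin d) = {⟨0, hk⟩} := by
        ext i
        simp [Fin.le_def, Fin.ext_iff]
      by_contra! h
      have hlarge := hno _ h
      rw [hIic, Finset.sum_singleton] at hlarge
      linarith
    | succ k ih =>
      intro hk
      have hprev := ih (by omega)
      have hIic : Finset.Iic (⟨k + 1, hk⟩ : Fin d) =
          insert ⟨k + 1, hk⟩ (Finset.Iic ⟨k, by omega⟩) := by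
        ext i
        simp only [Finset.mem_Iic, Finset.mem_insert, Fin.le_def, Fin.ext_iff]
        omega
      have hfirst : ((C ⟨k + 1, hk⟩).card : ℝ) ≤ (C ⟨0, hd⟩).card :=
        mod_cast hmono _ _ (by simp [Fin.le_def])
      have hzero : ((C ⟨0, hd⟩).card : ℝ) ≤
          ∑ i ∈ Finset.Iic (⟨k, by omega⟩ : Fin d), ((C i).card : ℝ) :=
        Finset.single_le_sum (f := fun i => ((C i).card : ℝ))
          (fun _ _ => Nat.cast_nonneg _) (by simp [Fin.le_def])
      by_contra! h
      have hlarge := hno _ h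
      rw [hIic, Finset.sum_insert (by simp [Fin.le_def])] at hlarge
      nlinarith
  have hlast := hsmall (d - 1) (by omega)
  have hIic : Finset.Iic (⟨d - 1, by omega⟩ : Fin d) = Finset.univ := by
    ext i
    simp only [Finset.mem_Iic, Finset.mem_univ, Fin.le_def, iff_true]
    omega
  rw [hIic, hsum] at hlast
  nlinarith
end

section
/- Let T be a tree with vertex set [n] and let Σ = [σ_ij] be an n×n real symmetric positive definite matrix whose normalized entries ρ_ij = σ_ij/√(σ_ii σ_jj) satisfy the path-product formula over T and additionally ρ_uv ≠ 0 for every edge uv of T. Then for any three distinct vertices u, v, w ∈ [n], det(Σ_{{u,w},{v,w}}) = σ_uv σ_ww − σ_uw σ_wv = 0 if and only if w lies on the path between u and v in T. -/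
open SimpleGraph

theorem SimpleGraph.Walk.IsPath.append_of_inter_subset {V : Type*} {G : SimpleGraph V}
    {u v w : V} {p : G.Walk u v} {q : G.Walk v w} (hp : p.IsPath) (hq : q.IsPath)
    (h : ∀ x ∈ p.support, x ∈ q.support → x = v) : (p.append q).IsPath := by
  induction p with
  | nil => simpa using hq
  | cons hadj p ih =>
    rw [Walk.cons_isPath_iff] at hp
    rw [Walk.cons_append, Walk.cons_isPath_iff, Walk.mem_support_append_iff]
    refine ⟨ih hp.1 hq fun x hx => h x (by simp [hx]), ?_⟩
    rintro (hmem | hmem)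
    · exact hp.2 hmem
    · exact hp.2 (h _ (by simp) hmem ▸ p.end_mem_support)

/-- A path ending in `s` has an initial segment that meets `s` only at its endpoint. -/
theorem SimpleGraph.Walk.IsPath.exists_isPath_to_first_mem {V : Type*} {G : SimpleGraph V}
    {w u : V} {q : G.Walk w u} (hq : q.IsPath) {s : Set V} (hu : u ∈ s) :
    ∃ m ∈ s, ∃ r : G.Walk w m,
      r.IsPath ∧ r.support ⊆ q.support ∧ ∀ x ∈ r.support, x ∈ s → x = m := by
  induction q with
  | nil => exact ⟨_, hu, .nil, .nil, by simp, by simp⟩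
  | @cons a b c hadj q ih =>
    rw [Walk.cons_isPath_iff] at hq
    by_cases ha : a ∈ s
    · exact ⟨a, ha, .nil, .nil, by simp, by simp⟩
    · obtain ⟨m, hm, r, hr, hsub, hrs⟩ := ih hq.1 hu
      refine ⟨m, hm, .cons hadj r, ?_, ?_, ?_⟩
      · exact (Walk.cons_isPath_iff _ _).2 ⟨hr, fun h => hq.2 (hsub h)⟩
      · rw [Walk.support_cons, Walk.support_cons]
        exact List.cons_subset_cons _ hsub
      · intro x hx hxs
        rw [Walk.support_cons, List.mem_cons] at hx
        rcases hx with rfl | hx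
        · exact absurd hxs ha
        · exact hrs x hx hxs

/-- In a connected graph, every vertex is joined to a path by a path meeting it only at the
endpoint. -/
theorem SimpleGraph.Connected.exists_isPath_to_first_mem_support {V : Type*}
    {G : SimpleGraph V} (hG : G.Connected) {u v : V} (p : G.Walk u v) (w : V) :
    ∃ m ∈ p.support, ∃ r : G.Walk w m, r.IsPath ∧ ∀ x ∈ r.support, x ∈ p.support → x = m := by
  obtain ⟨q, hq⟩ := (hG w u).exists_isPath
  obtain ⟨m, hm, r, hr, -, hrs⟩ :=
    hq.exists_isPath_to_first_mem (s := {x | x ∈ p.support}) p.start_mem_support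
  exact ⟨m, hm, r, hr, hrs⟩

theorem Matrix.PosDef.mul_self_lt_mul_diag {ι : Type*} {S : Matrix ι ι ℝ} (hS : S.PosDef)
    {i j : ι} (hij : i ≠ j) : S i j * S i j < S i i * S j j := by
  have hinj : Function.Injective ![i, j] := by
    intro a b hab
    fin_cases a <;> fin_cases b <;> simp_all [eq_comm]
  have hdet := (hS.submatrix hinj).det_pos
  have hsymm : S j i = S i j := by simpa using hS.isHermitian.apply i j
  simp only [Matrix.det_fin_two, Matrix.submatrix_apply, Matrix.cons_val_zero,
    Matrix.cons_val_one, hsymm] at hdet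
  linarith

section NormEntry

variable {n : ℕ} {S : Matrix (Fin n) (Fin n) ℝ}

theorem normEntry_comm (hS : S.IsSymm) (i j : Fin n) : normEntry S i j = normEntry S j i := by
  rw [normEntry, normEntry, hS.apply i j, mul_comm]

theorem eq_normEntry_mul (hS : S.PosDef) (i j : Fin n) :
    S i j = normEntry S i j * (√(S i i) * √(S j j)) := by
  have hi : 0 < √(S i i) := Real.sqrt_pos.2 hS.diag_pos
  have hj : 0 < √(S j j) := Real.sqrt_pos.2 hS.diag_pos
  rw [normEntry, Real.sqrt_mul hS.diag_pos.le]
  field_simp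

theorem normEntry_mul_self_lt_one (hS : S.PosDef) {i j : Fin n} (hij : i ≠ j) :
    normEntry S i j * normEntry S i j < 1 := by
  have hpos : 0 < S i i * S j j := mul_pos hS.diag_pos hS.diag_pos
  rw [normEntry, div_mul_div_comm, Real.mul_self_sqrt hpos.le, div_lt_one hpos]
  exact hS.mul_self_lt_mul_diag hij

theorem minor_eq_zero_iff_normEntry_eq_mul (hS : S.PosDef) (u v w : Fin n) :
    S u v * S w w - S u w * S w v = 0 ↔
      normEntry S u v = normEntry S u w * normEntry S w v := by
  have hu : 0 < √(S u u) := Real.sqrt_pos.2 hS.diag_pos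
  have hv : 0 < √(S v v) := Real.sqrt_pos.2 hS.diag_pos
  have hw : 0 < S w w := hS.diag_pos
  have hww : √(S w w) * √(S w w) = S w w := Real.mul_self_sqrt hw.le
  have key : S u v * S w w - S u w * S w v =
      (normEntry S u v - normEntry S u w * normEntry S w v) *
        (√(S u u) * √(S v v) * S w w) := by
    rw [eq_normEntry_mul hS u v, eq_normEntry_mul hS u w, eq_normEntry_mul hS w v]
    linear_combination
      -(normEntry S u w * normEntry S w v * √(S u u) * √(S v v)) * hww
  rw [key, mul_eq_zero, or_iff_left (by positivity), sub_eq_zero]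

variable {T : SimpleGraph (Fin n)}

theorem normEntry_eq_mul_of_isPath_append
    (hprod : ∀ (i j : Fin n) (p : T.Path i j),
      normEntry S i j =
        ((p : T.Walk i j).darts.map (fun d => normEntry S d.toProd.1 d.toProd.2)).prod)
    {i j k : Fin n} {p : T.Walk i j} {q : T.Walk j k} (h : (p.append q).IsPath) :
    normEntry S i k = normEntry S i j * normEntry S j k := by
  rw [hprod i k ⟨_, h⟩, hprod i j ⟨p, h.of_append_left⟩, hprod j k ⟨q, h.of_append_right⟩]
  simp

theorem normEntry_ne_zero_of_path
    (hprod : ∀ (i j : Fin n) (p : T.Path i j),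
      normEntry S i j =
        ((p : T.Walk i j).darts.map (fun d => normEntry S d.toProd.1 d.toProd.2)).prod)
    (hedge : ∀ u v : Fin n, T.Adj u v → normEntry S u v ≠ 0)
    {i j : Fin n} (p : T.Path i j) : normEntry S i j ≠ 0 := by
  rw [hprod i j p]
  refine List.prod_ne_zero fun h => ?_
  obtain ⟨d, -, hd⟩ := List.mem_map.1 h
  exact hedge _ _ d.adj hd

end NormEntry

/-- Let `T` be a tree on `[n]` and `S` a symmetric positive definite
matrix whose normalized entries satisfy the path-product formula over `T` with nonzero
values on the edges. Then for distinct `u, v, w`,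
`det S_{{u,w},{v,w}} = S_uv S_ww − S_uw S_wv = 0` iff `w` lies on the path from `u` to `v`. -/
theorem det_eq_zero_iff_on_path {n : ℕ} (T : SimpleGraph (Fin n)) (hT : T.IsTree)
    (S : Matrix (Fin n) (Fin n) ℝ) (hpd : S.PosDef) (hsymm : S.IsSymm)
    (hprod : ∀ (i j : Fin n) (p : T.Path i j),
      normEntry S i j =
        ((p : T.Walk i j).darts.map (fun d => normEntry S d.toProd.1 d.toProd.2)).prod)
    (hedge : ∀ u v : Fin n, T.Adj u v → normEntry S u v ≠ 0)
    (u v w : Fin n) (huv : u ≠ v) (huw : u ≠ w) (hvw : v ≠ w) :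
    ∀ p : T.Path u v,
      (S u v * S w w - S u w * S w v = 0 ↔ w ∈ (p : T.Walk u v).support) := by
  rintro ⟨p, hp⟩
  rw [minor_eq_zero_iff_normEntry_eq_mul hpd]
  refine ⟨fun h => ?_, fun hw => ?_⟩
  · by_contra hw
    obtain ⟨m, hm, r, hr, hrp⟩ := hT.connected.exists_isPath_to_first_mem_support p w
    obtain ⟨p₁, p₂, rfl⟩ := Walk.mem_support_iff_exists_append.1 hm
    have hmw : m ≠ w := by
      rintro rfl
      exact hw hm
    have h₁ : (r.append p₁.reverse).IsPath :=
      hr.append_of_inter_subset hp.of_append_left.reverse fun x hx hx' =>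
        hrp x hx ((Walk.mem_support_append_iff _ _).2 (.inl (by simpa using hx')))
    have h₂ : (r.append p₂).IsPath :=
      hr.append_of_inter_subset hp.of_append_right fun x hx hx' =>
        hrp x hx ((Walk.mem_support_append_iff _ _).2 (.inr hx'))
    have huv_eq := normEntry_eq_mul_of_isPath_append hprod hp
    have hwu_eq := normEntry_eq_mul_of_isPath_append hprod h₁
    have hwv_eq := normEntry_eq_mul_of_isPath_append hprod h₂
    have hne := normEntry_ne_zero_of_path hprod hedge ⟨_, hp⟩
    have hlt := normEntry_mul_self_lt_one hpd hmw.symm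
    rw [normEntry_comm hsymm u w, hwu_eq, hwv_eq, normEntry_comm hsymm m u] at h
    refine hlt.ne (mul_left_cancel₀ hne ?_)
    rw [mul_one]
    nth_rewrite 1 [huv_eq]
    linear_combination -h
  · obtain ⟨p₁, p₂, rfl⟩ := Walk.mem_support_iff_exists_append.1 hw
    exact normEntry_eq_mul_of_isPath_append hprod hp
end

section
/- Let T be a tree with vertex set [n], diameter D, and let Σ = [σ_ij] be a symmetric matrix with σ_ii = 1 whose entries satisfy the path-product formula over T, with δ ≤ |σ_uv| ≤ γ for every edge uv of T, where 0 < δ < γ < 1. Then for any three distinct vertices i, j, k ∈ [n] such that j does not lie on the path between i and k in T (equivalently, σ_ij σ_jk ≠ σ_ik), one has |σ_ij σ_jk − σ_ik| ≥ δ^D (1 − γ²). -/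
open SimpleGraph

namespace SimpleGraph.Walk

variable {V : Type*} {G : SimpleGraph V}

theorem IsPath.append_of_inter_eq {u v w : V} {p : G.Walk u v} {q : G.Walk v w}
    (hp : p.IsPath) (hq : q.IsPath) (h : ∀ x ∈ p.support, x ∈ q.support → x = v) :
    (p.append q).IsPath := by
  have hq' := hq.support_nodup
  rw [← cons_tail_support, List.nodup_cons] at hq'
  rw [isPath_def, support_append, List.nodup_append']
  refine ⟨hp.support_nodup, hq'.2, fun x hx hxq => hq'.1 ?_⟩
  exact (h x hx (List.mem_of_mem_tail hxq)) ▸ hxq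

/-- A walk ending in a set of vertices yields a path to that set meeting it only at its end. -/
theorem exists_isPath_first_mem (s : Set V) {u v : V} (q : G.Walk u v) (hv : v ∈ s) :
    ∃ m ∈ s, ∃ r : G.Walk u m, r.IsPath ∧ ∀ x ∈ r.support, x ∈ s → x = m := by
  classical
  induction q with
  | nil => exact ⟨_, hv, nil, IsPath.nil, by simp⟩
  | @cons a b c h q ih =>
    by_cases ha : a ∈ s
    · exact ⟨a, ha, nil, IsPath.nil, by simp⟩
    · obtain ⟨m, hm, r, -, hr⟩ := ih hv
      refine ⟨m, hm, (cons h r).bypass, bypass_isPath _, fun x hx hxs => ?_⟩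
      rcases List.mem_cons.1 (support_bypass_subset_support _ hx) with rfl | hx
      · exact absurd hxs ha
      · exact hr x hx hxs

/-- The product of the entries of `S` along the darts of a walk. -/
def dartProd (S : Matrix V V ℝ) {u v : V} (p : G.Walk u v) : ℝ :=
  (p.darts.map (fun d => S d.toProd.1 d.toProd.2)).prod

theorem dartProd_append (S : Matrix V V ℝ) {u v w : V} (p : G.Walk u v) (q : G.Walk v w) :
    (p.append q).dartProd S = p.dartProd S * q.dartProd S := by
  simp [dartProd]

theorem dartProd_cons (S : Matrix V V ℝ) {u v w : V} (h : G.Adj u v) (p : G.Walk v w) :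
    (cons h p).dartProd S = S u v * p.dartProd S := by
  simp [dartProd]

theorem pow_length_le_abs_dartProd {S : Matrix V V ℝ} {δ : ℝ} (hδ : 0 ≤ δ)
    (hS : ∀ u v, G.Adj u v → δ ≤ |S u v|) {u v : V} (p : G.Walk u v) :
    δ ^ p.length ≤ |p.dartProd S| := by
  induction p with
  | nil => simp [dartProd]
  | cons h p ih =>
    rw [dartProd_cons, abs_mul, length_cons, pow_succ']
    exact mul_le_mul (hS _ _ h) ih (by positivity) (abs_nonneg _)

theorem abs_dartProd_le_pow_length {S : Matrix V V ℝ} {γ : ℝ} (hγ : 0 ≤ γ)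
    (hS : ∀ u v, G.Adj u v → |S u v| ≤ γ) {u v : V} (p : G.Walk u v) :
    |p.dartProd S| ≤ γ ^ p.length := by
  induction p with
  | nil => simp [dartProd]
  | cons h p ih =>
    rw [dartProd_cons, abs_mul, length_cons, pow_succ']
    exact mul_le_mul (hS _ _ h) ih (abs_nonneg _) hγ

end SimpleGraph.Walk

/-- Let `T` be a tree on `[n]` with diameter at most `D`, and `S` a
symmetric matrix with unit diagonal satisfying the path-product formula over `T`, with
`δ ≤ |S u v| ≤ γ` on edges, `0 < δ < γ < 1`. Then for distinct `i, j, k` such that `j` does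
not lie on the path between `i` and `k`, `|S i j * S j k − S i k| ≥ δ^D (1 − γ²)`. -/
theorem offpath_gap_bound {n : ℕ} (T : SimpleGraph (Fin n)) (hT : T.IsTree)
    (S : Matrix (Fin n) (Fin n) ℝ) (hsymm : S.IsSymm) (hdiag : ∀ i, S i i = 1)
    (hprod : ∀ (i j : Fin n) (p : T.Path i j),
      S i j = ((p : T.Walk i j).darts.map (fun d => S d.toProd.1 d.toProd.2)).prod)
    (δ γ : ℝ) (hδ : 0 < δ) (hδγ : δ < γ) (hγ : γ < 1)
    (hedge : ∀ u v : Fin n, T.Adj u v → δ ≤ |S u v| ∧ |S u v| ≤ γ)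
    (D : ℕ) (hD : ∀ i j : Fin n, T.dist i j ≤ D)
    (i j k : Fin n) (hij : i ≠ j) (hik : i ≠ k) (hjk : j ≠ k)
    (hoff : ∀ p : T.Path i k, j ∉ (p : T.Walk i k).support) :
    δ ^ D * (1 - γ ^ 2) ≤ |S i j * S j k - S i k| := by
  classical
  have hS : ∀ {u v : Fin n} (p : T.Walk u v), p.IsPath → S u v = p.dartProd S :=
    fun p hp => hprod _ _ ⟨p, hp⟩
  have hγ0 : 0 < γ := hδ.trans hδγ
  obtain ⟨p, hp, hlen⟩ := hT.connected.exists_path_of_dist i k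
  obtain ⟨q⟩ := hT.connected.preconnected j k
  obtain ⟨m, hm, r, hr, hrp⟩ := q.exists_isPath_first_mem {x | x ∈ p.support} p.end_mem_support
  have hm' : m ∈ p.support := hm
  have hjm : j ≠ m := by
    rintro rfl
    exact hoff ⟨p, hp⟩ hm'
  have h_ik : S i k = S i m * S m k := by
    rw [hS _ (hp.takeUntil hm'), hS _ (hp.dropUntil hm'), ← Walk.dartProd_append,
      p.take_spec hm', hS p hp]
  have h_ij : S i j = S i m * S j m := by
    have h := (hp.takeUntil hm').append_of_inter_eq hr.reverse fun x hx hxr =>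
      hrp x (by simpa using hxr) (p.support_takeUntil_subset_support hm' hx)
    rw [hS _ h, Walk.dartProd_append, ← hS _ (hp.takeUntil hm'), ← hS _ hr.reverse,
      hsymm.apply j m]
  have h_jk : S j k = S j m * S m k := by
    have h := hr.append_of_inter_eq (hp.dropUntil hm') fun x hxr hx =>
      hrp x hxr (p.support_dropUntil_subset_support hm' hx)
    rw [hS _ h, Walk.dartProd_append, ← hS _ hr, ← hS _ (hp.dropUntil hm')]
  have h_low : δ ^ D ≤ |S i k| := by
    rw [hS p hp]
    refine le_trans ?_ (p.pow_length_le_abs_dartProd hδ.le fun u v h => (hedge u v h).1)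
    exact pow_le_pow_of_le_one hδ.le (hδγ.trans hγ).le (hlen ▸ hD i k)
  have h_up : |S j m| ≤ γ := by
    rw [hS r hr]
    refine (r.abs_dartProd_le_pow_length hγ0.le fun u v h => (hedge u v h).2).trans ?_
    exact pow_le_of_le_one hγ0.le hγ.le fun h0 => hjm (Walk.eq_of_length_eq_zero h0)
  have h_sq : S j m ^ 2 ≤ γ ^ 2 := sq_le_sq' (abs_le.1 h_up).1 (abs_le.1 h_up).2
  have h_one : γ ^ 2 ≤ 1 := pow_le_one₀ hγ0.le hγ.le
  have h_eq : S i j * S j k - S i k = -(S i k * (1 - S j m ^ 2)) := by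
    rw [h_ij, h_jk, h_ik]
    ring
  rw [h_eq, abs_neg, abs_mul, abs_of_nonneg (by linarith : 0 ≤ 1 - S j m ^ 2)]
  exact mul_le_mul h_low (by linarith) (by linarith) (abs_nonneg _)
end

section
/- Let T be a tree with vertex set [n], diameter D, and let Σ = [σ_ij] be a symmetric matrix with σ_ii = 1 whose entries satisfy the path-product formula over T, with δ ≤ |σ_uv| ≤ γ for every edge uv of T, where 0 < δ < γ < 1. Let Σ̂ = [σ̂_ij] be a symmetric matrix with entries in [−1, 1], σ̂_ii = 1, and |σ̂_ij − σ_ij| < ε for all i, j, where ε ≤ (1/8) δ^D (1 − γ²). Let τ be any real number with 3ε < τ ≤ δ^D (1 − γ²) − 3ε. Then for any three distinct vertices i, j, k ∈ [n]: if j lies on the path between i and k in T then |σ̂_ij σ̂_jk − σ̂_ik| < τ, and if j does not lie on the path between i and k then |σ̂_ij σ̂_jk − σ̂_ik| > τ. -/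
open SimpleGraph

namespace SimpleGraph

variable {V : Type*} {G : SimpleGraph V}

/-- The product of the entries of `S` along the darts of a walk. -/
def Walk.entryProd (S : Matrix V V ℝ) {u v : V} (p : G.Walk u v) : ℝ :=
  (p.darts.map fun d => S d.toProd.1 d.toProd.2).prod

theorem Walk.entryProd_append (S : Matrix V V ℝ) {u v w : V} (p : G.Walk u v) (q : G.Walk v w) :
    (p.append q).entryProd S = p.entryProd S * q.entryProd S := by
  simp [entryProd, Walk.darts_append]

theorem Walk.entryProd_cons (S : Matrix V V ℝ) {u v w : V} (h : G.Adj u v) (p : G.Walk v w) :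
    (Walk.cons h p).entryProd S = S u v * p.entryProd S := by
  simp [entryProd]

theorem Walk.pow_length_le_abs_entryProd {S : Matrix V V ℝ} {δ : ℝ} (hδ : 0 ≤ δ)
    (hS : ∀ u v, G.Adj u v → δ ≤ |S u v|) {u v : V} (p : G.Walk u v) :
    δ ^ p.length ≤ |p.entryProd S| := by
  induction p with
  | nil => simp [entryProd]
  | cons h p ih =>
    rw [entryProd_cons, abs_mul, Walk.length_cons, pow_succ']
    exact mul_le_mul (hS _ _ h) ih (pow_nonneg hδ _) (abs_nonneg _)

theorem Walk.abs_entryProd_le_pow_length {S : Matrix V V ℝ} {γ : ℝ}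
    (hS : ∀ u v, G.Adj u v → |S u v| ≤ γ) {u v : V} (p : G.Walk u v) :
    |p.entryProd S| ≤ γ ^ p.length := by
  induction p with
  | nil => simp [entryProd]
  | cons h p ih =>
    rw [entryProd_cons, abs_mul, Walk.length_cons, pow_succ']
    exact mul_le_mul (hS _ _ h) ih (abs_nonneg _) ((abs_nonneg _).trans (hS _ _ h))

theorem Walk.IsPath.append_of_support_inter {u v w : V} {p : G.Walk u v} {q : G.Walk v w}
    (hp : p.IsPath) (hq : q.IsPath) (h : ∀ x ∈ p.support, x ∈ q.support → x = v) :
    (p.append q).IsPath := by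
  rw [Walk.isPath_def, Walk.support_append, List.nodup_append']
  refine ⟨hp.support_nodup, hq.support_nodup.tail, fun x hxp hxq => ?_⟩
  obtain rfl := h x hxp (List.mem_of_mem_tail hxq)
  have hnd := hq.support_nodup
  rw [← Walk.cons_tail_support] at hnd
  exact (List.nodup_cons.mp hnd).1 hxq

/-- Every vertex `j` can be attached to a path from `i` to `k` by a path that meets it
in a single vertex `m`. -/
theorem Connected.exists_isPath_append [DecidableEq V] (hG : G.Connected) {i k : V}
    (p : G.Walk i k) (j : V) :
    ∃ (m : V) (_ : m ∈ p.support) (r : G.Walk j m), r.IsPath ∧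
      ∀ x ∈ p.support, x ∈ r.support → x = m := by
  obtain ⟨q⟩ := hG j i
  obtain ⟨m, hm, hmq, h⟩ := q.exists_mem_support_forall_mem_support_imp_eq p.support.toFinset
    ⟨i, by simp⟩
  refine ⟨m, by simpa using hm, (q.takeUntil m hmq).bypass, Walk.bypass_isPath _,
    fun x hx hxr => ?_⟩
  exact h x (by simpa using hx) (Walk.support_bypass_subset_support _ hxr)

section PathProduct

variable {S : Matrix V V ℝ}

theorem entry_eq_mul_of_mem_support [DecidableEq V]
    (hS : ∀ {u v : V} (p : G.Walk u v), p.IsPath → S u v = p.entryProd S)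
    {i j k : V} {p : G.Walk i k} (hp : p.IsPath) (hj : j ∈ p.support) :
    S i k = S i j * S j k := by
  rw [hS p hp, hS _ (hp.takeUntil hj), hS _ (hp.dropUntil hj), ← Walk.entryProd_append,
    Walk.take_spec]

theorem pow_le_abs_entry [DecidableEq V] (hG : G.Connected)
    (hS : ∀ {u v : V} (p : G.Walk u v), p.IsPath → S u v = p.entryProd S)
    {δ : ℝ} (hδ : 0 ≤ δ) (hδ1 : δ ≤ 1) (hlow : ∀ u v, G.Adj u v → δ ≤ |S u v|)
    {D : ℕ} (hD : ∀ u v, G.dist u v ≤ D) (u v : V) : δ ^ D ≤ |S u v| := by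
  obtain ⟨q, hq⟩ := hG.exists_walk_length_eq_dist u v
  rw [hS _ q.bypass_isPath]
  refine le_trans (pow_le_pow_of_le_one hδ hδ1 ?_)
    (Walk.pow_length_le_abs_entryProd hδ hlow q.bypass)
  exact q.length_bypass_le_length.trans (hq ▸ hD u v)

theorem abs_entry_le [DecidableEq V] (hG : G.Connected)
    (hS : ∀ {u v : V} (p : G.Walk u v), p.IsPath → S u v = p.entryProd S)
    {γ : ℝ} (hγ : 0 ≤ γ) (hγ1 : γ ≤ 1) (hup : ∀ u v, G.Adj u v → |S u v| ≤ γ)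
    {u v : V} (huv : u ≠ v) : |S u v| ≤ γ := by
  obtain ⟨q⟩ := hG u v
  rw [hS _ q.bypass_isPath]
  refine (Walk.abs_entryProd_le_pow_length hup q.bypass).trans (pow_le_of_le_one hγ hγ1 ?_)
  exact fun h => huv (Walk.eq_of_length_eq_zero h)

/-- The three entries at `i`, `j`, `k` satisfy `S i j * S j k = S i k * S j m ^ 2`, where `m` is a
vertex at which `j` attaches to the path `p`. -/
theorem exists_entry_mul_entry_eq [DecidableEq V] (hG : G.Connected) (hsymm : S.IsSymm)
    (hS : ∀ {u v : V} (p : G.Walk u v), p.IsPath → S u v = p.entryProd S)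
    {i k : V} {p : G.Walk i k} (hp : p.IsPath) (j : V) :
    ∃ m ∈ p.support, S i j * S j k = S i k * S j m ^ 2 := by
  obtain ⟨m, hm, r, hr, hrp⟩ := hG.exists_isPath_append p j
  refine ⟨m, hm, ?_⟩
  have hij : S i j = S i m * S m j := by
    refine entry_eq_mul_of_mem_support hS
      ((hp.takeUntil hm).append_of_support_inter hr.reverse fun x hx hxr => ?_)
      (by simp [Walk.mem_support_append_iff])
    exact hrp x (p.support_takeUntil_subset_support hm hx) (by simpa using hxr)
  have hjk : S j k = S j m * S m k := by
    refine entry_eq_mul_of_mem_support hS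
      (hr.append_of_support_inter (hp.dropUntil hm) fun x hxr hx => ?_)
      (by simp [Walk.mem_support_append_iff])
    exact hrp x (p.support_dropUntil_subset_support hm hx) hxr
  rw [hij, hjk, entry_eq_mul_of_mem_support hS hp hm, hsymm.apply j m]
  ring

end PathProduct

end SimpleGraph

theorem abs_mul_sub_sub_mul_sub_lt {a b c a' b' c' ε : ℝ} (ha' : |a'| ≤ 1) (hb : |b| ≤ 1)
    (ha : |a' - a| < ε) (hb' : |b' - b| < ε) (hc : |c' - c| < ε) :
    |(a' * b' - c') - (a * b - c)| < 3 * ε := by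
  have h : (a' * b' - c') - (a * b - c) = a' * (b' - b) + b * (a' - a) - (c' - c) := by ring
  have h1 : |a' * (b' - b)| ≤ |b' - b| := by
    rw [abs_mul]; exact mul_le_of_le_one_left (abs_nonneg _) ha'
  have h2 : |b * (a' - a)| ≤ |a' - a| := by
    rw [abs_mul]; exact mul_le_of_le_one_left (abs_nonneg _) hb
  have h3 := abs_sub (a' * (b' - b) + b * (a' - a)) (c' - c)
  have h4 := abs_add_le (a' * (b' - b)) (b * (a' - a))
  rw [h]
  linarith

/-- Let `T` be a tree on `[n]` with diameter at most `D`, and `S` a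
symmetric matrix with unit diagonal satisfying the path-product formula over `T`, with
`δ ≤ |S u v| ≤ γ` on edges, `0 < δ < γ < 1`. Let `Sh` be a symmetric matrix with entries in
`[−1,1]`, unit diagonal, and `|Sh i j − S i j| < ε` where `ε ≤ (1/8)δ^D(1−γ²)`, and let
`3ε < τ ≤ δ^D(1−γ²) − 3ε`. Then for distinct `i, j, k`: if `j` lies on the path between `i`
and `k` then `|Sh i j * Sh j k − Sh i k| < τ`, and otherwise `|Sh i j * Sh j k − Sh i k| > τ`. -/
theorem noisy_separation_test {n : ℕ} (T : SimpleGraph (Fin n)) (hT : T.IsTree)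
    (S : Matrix (Fin n) (Fin n) ℝ) (hsymm : S.IsSymm) (hdiag : ∀ i, S i i = 1)
    (hprod : ∀ (i j : Fin n) (p : T.Path i j),
      S i j = ((p : T.Walk i j).darts.map (fun d => S d.toProd.1 d.toProd.2)).prod)
    (δ γ : ℝ) (hδ : 0 < δ) (hδγ : δ < γ) (hγ : γ < 1)
    (hedge : ∀ u v : Fin n, T.Adj u v → δ ≤ |S u v| ∧ |S u v| ≤ γ)
    (D : ℕ) (hD : ∀ i j : Fin n, T.dist i j ≤ D)
    (Sh : Matrix (Fin n) (Fin n) ℝ) (hShsymm : Sh.IsSymm)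
    (hShrange : ∀ i j, Sh i j ∈ Set.Icc (-1 : ℝ) 1) (hShdiag : ∀ i, Sh i i = 1)
    (ε : ℝ) (hnoise : ∀ i j, |Sh i j - S i j| < ε)
    (hε : ε ≤ (1 / 8) * δ ^ D * (1 - γ ^ 2))
    (τ : ℝ) (hτl : 3 * ε < τ) (hτu : τ ≤ δ ^ D * (1 - γ ^ 2) - 3 * ε)
    (i j k : Fin n) (hij : i ≠ j) (hik : i ≠ k) (hjk : j ≠ k) :
    ((∃ p : T.Path i k, j ∈ (p : T.Walk i k).support) →
        |Sh i j * Sh j k - Sh i k| < τ) ∧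
      ((∀ p : T.Path i k, j ∉ (p : T.Walk i k).support) →
        τ < |Sh i j * Sh j k - Sh i k|) := by
  classical
  have hconn := hT.connected
  have hS : ∀ {u v : Fin n} (p : T.Walk u v), p.IsPath → S u v = p.entryProd S :=
    fun p hp => hprod _ _ ⟨p, hp⟩
  have hγ0 : 0 ≤ γ := (hδ.trans hδγ).le
  have hup : ∀ {u v : Fin n}, u ≠ v → |S u v| ≤ γ :=
    abs_entry_le hconn hS hγ0 hγ.le fun u v h => (hedge u v h).2
  have herr := abs_mul_sub_sub_mul_sub_lt (abs_le.mpr (hShrange i j)) ((hup hjk).trans hγ.le)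
    (hnoise i j) (hnoise j k) (hnoise i k)
  constructor
  · rintro ⟨p, hj⟩
    rw [entry_eq_mul_of_mem_support hS p.isPath hj, sub_self, sub_zero] at herr
    exact herr.trans hτl
  · intro h
    obtain ⟨w⟩ := hconn i k
    obtain ⟨m, hm, hmul⟩ := exists_entry_mul_entry_eq hconn hsymm hS w.bypass_isPath j
    have hjm : j ≠ m := by
      rintro rfl
      exact h ⟨w.bypass, w.bypass_isPath⟩ hm
    have hsq : S j m ^ 2 ≤ γ ^ 2 := sq_le_sq' (abs_le.mp (hup hjm)).1 (abs_le.mp (hup hjm)).2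
    have hγsq : γ ^ 2 ≤ 1 := pow_le_one₀ hγ0 hγ.le
    have hlow : δ ^ D * (1 - γ ^ 2) ≤ |S i j * S j k - S i k| := by
      have hfac : S i j * S j k - S i k = -(S i k * (1 - S j m ^ 2)) := by rw [hmul]; ring
      rw [hfac, abs_neg, abs_mul, abs_of_nonneg (by linarith : 0 ≤ 1 - S j m ^ 2)]
      exact mul_le_mul (pow_le_abs_entry hconn hS hδ.le (hδγ.trans hγ).le
        (fun u v h => (hedge u v h).1) hD i k) (by linarith) (by linarith) (abs_nonneg _)
    have htri := abs_sub_abs_le_abs_sub (S i j * S j k - S i k) (Sh i j * Sh j k - Sh i k)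
    rw [abs_sub_comm (S i j * S j k - S i k) (Sh i j * Sh j k - Sh i k)] at htri
    linarith
end

section
/- Let T be a tree with vertex set [n] and let Σ = [σ_ij] be a symmetric matrix with σ_ii = 1 whose entries satisfy the path-product formula over T, with δ ≤ |σ_uv| ≤ γ for every edge uv of T, where 0 < δ < γ < 1. Let w ∈ [n], let v be a neighbor of w in T, and let u be a vertex distinct from v and w lying in the same connected component of T ∖ w as v. Then |σ_vw| − |σ_uw| ≥ δ(1 − γ). Consequently, if Σ̂ = [σ̂_ij] satisfies |σ̂_ij − σ_ij| < ε for all i, j with 4ε ≤ δ(1 − γ), then |σ̂_vw| > |σ̂_uw| + 2ε. -/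
open SimpleGraph

/-- The product of edge weights along a walk has absolute value at most one when every edge
weight has. -/
theorem SimpleGraph.Walk.abs_prod_darts_le_one {V : Type*} {G : SimpleGraph V}
    {f : V → V → ℝ} (hf : ∀ a b, G.Adj a b → |f a b| ≤ 1) {x y : V} (p : G.Walk x y) :
    |(p.darts.map (fun d => f d.toProd.1 d.toProd.2)).prod| ≤ 1 := by
  induction p with
  | nil => simp
  | cons h p ih =>
    simpa [abs_mul] using mul_le_one₀ (hf _ _ h) (abs_nonneg _) ih

/-- The product of edge weights along a walk between distinct vertices is bounded in absolute
value by any upper bound `c ≤ 1` for the edge weights. -/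
theorem SimpleGraph.Walk.abs_prod_darts_le_of_ne {V : Type*} {G : SimpleGraph V}
    {f : V → V → ℝ} {c : ℝ} (hc : c ≤ 1) (hf : ∀ a b, G.Adj a b → |f a b| ≤ c) {x y : V}
    (p : G.Walk x y) (hxy : x ≠ y) :
    |(p.darts.map (fun d => f d.toProd.1 d.toProd.2)).prod| ≤ c := by
  cases p with
  | nil => exact absurd rfl hxy
  | cons h p =>
    have h_tail := p.abs_prod_darts_le_one fun a b hab => (hf a b hab).trans hc
    simpa [abs_mul] using (mul_le_of_le_one_right (abs_nonneg _) h_tail).trans (hf _ _ h)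

/-- Let `T` be a tree on `[n]` and `S` a symmetric matrix with unit
diagonal satisfying the path-product formula over `T`, with `δ ≤ |S u v| ≤ γ` on edges,
`0 < δ < γ < 1`. If `v` is a neighbor of `w` and `u ∉ {v, w}` lies in the same connected
component of `T ∖ w` as `v`, then `|S v w| − |S u w| ≥ δ(1−γ)`; consequently for any `Sh`
with `|Sh i j − S i j| < ε` for all `i, j` and `4ε ≤ δ(1−γ)`, one has
`|Sh v w| > |Sh u w| + 2ε`. -/
theorem neighbor_correlation_gap {n : ℕ} (T : SimpleGraph (Fin n)) (hT : T.IsTree)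
    (S : Matrix (Fin n) (Fin n) ℝ) (hsymm : S.IsSymm) (hdiag : ∀ i, S i i = 1)
    (hprod : ∀ (i j : Fin n) (p : T.Path i j),
      S i j = ((p : T.Walk i j).darts.map (fun d => S d.toProd.1 d.toProd.2)).prod)
    (δ γ : ℝ) (hδ : 0 < δ) (hδγ : δ < γ) (hγ : γ < 1)
    (hedge : ∀ a b : Fin n, T.Adj a b → δ ≤ |S a b| ∧ |S a b| ≤ γ)
    (u v w : Fin n) (hvw : T.Adj v w) (huv : u ≠ v) (huw : u ≠ w)
    (hsame : ∃ p : T.Walk u v, ∀ x ∈ p.support, x ≠ w) :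
    δ * (1 - γ) ≤ |S v w| - |S u w| ∧
      ∀ (Sh : Matrix (Fin n) (Fin n) ℝ) (ε : ℝ),
        (∀ i j, |Sh i j - S i j| < ε) → 4 * ε ≤ δ * (1 - γ) →
          |Sh u w| + 2 * ε < |Sh v w| := by
  obtain ⟨p, hp⟩ := hsame
  have h_path : (p.bypass.concat hvw).IsPath :=
    p.bypass_isPath.concat (fun h => hp w (p.support_bypass_subset_support h) rfl) hvw
  have h_uv : |S u v| ≤ γ := by
    rw [hprod u v ⟨p.bypass, p.bypass_isPath⟩]
    exact p.bypass.abs_prod_darts_le_of_ne hγ.le (fun a b hab => (hedge a b hab).2) huv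
  have h_mul : |S u w| = |S u v| * |S v w| := by
    rw [← abs_mul, hprod u w ⟨_, h_path⟩, hprod u v ⟨p.bypass, p.bypass_isPath⟩]
    simp [Walk.darts_concat]
  have h_gap : δ * (1 - γ) ≤ |S v w| - |S u w| := by
    nlinarith [mul_le_mul_of_nonneg_right h_uv (abs_nonneg (S v w)), (hedge v w hvw).1]
  refine ⟨h_gap, fun Sh ε hSh hε => ?_⟩
  have h_vw := (abs_sub_abs_le_abs_sub (S v w) (Sh v w)).trans_lt
    ((abs_sub_comm _ _).trans_lt (hSh v w))
  have h_uw := (abs_sub_abs_le_abs_sub (Sh u w) (S u w)).trans_lt (hSh u w)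
  linarith
end
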